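/- There exists a function γ : (0,1) → (0,1) with 0 < γ(ε) < ε such that for every measure space with a positive measure μ, the real space L₁(μ) has the approximate hyperplane sum property for ℓ∞⁴ with the function γ. Consequently, there exists a function η : (0,1) → (0,1) with 0 < η(ε) < ε such that for every positive measure μ the pair (ℓ∞⁴, L₁(μ)) has the Bishop–Phelps–Bollobás property for operators with the function η. -/

import Mathlib

open MeasureTheory

/-- `M_Y^4`: quadruples `(y₁,y₂,y₃,y₄)` in the closed unit ball of `Y` such that
`‖y_{i₁} − y_{i₂} + y_{i₃}‖ ≤ 1` for all `i₁ < i₂ < i₃`. -/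
def MY4 {Y : Type*} [NormedAddCommGroup Y] (y : Fin 4 → Y) : Prop :=
  (∀ i, ‖y i‖ ≤ 1) ∧
    ∀ i j k : Fin 4, i < j → j < k → ‖y i - y j + y k‖ ≤ 1

/-- `Y` has the approximate hyperplane sum property for `ℓ∞⁴` with the function `γ`. -/
def AHSpL4With (Y : Type*) [NormedAddCommGroup Y] [NormedSpace ℝ Y] (γ : ℝ → ℝ) : Prop :=
  ∀ ε : ℝ, 0 < ε → ε < 1 →
    (0 < γ ε ∧ γ ε < ε) ∧
    ∀ y : Fin 4 → Y, MY4 y →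
      ∀ A : Finset (Fin 4), A.Nonempty →
        ∀ f : Y →L[ℝ] ℝ, ‖f‖ = 1 →
          (∀ i ∈ A, 1 - γ ε < f (y i)) →
          ∃ z : Fin 4 → Y, MY4 z ∧ (∀ i, ‖z i - y i‖ < ε) ∧
            ‖∑ i ∈ A, z i‖ = (A.card : ℝ)

/-- The pair `(X, Y)` has the Bishop–Phelps–Bollobás property for operators with function `η`. -/
def BPBpWith (X Y : Type*) [NormedAddCommGroup X] [NormedSpace ℝ X]
    [NormedAddCommGroup Y] [NormedSpace ℝ Y] (η : ℝ → ℝ) : Prop :=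
  ∀ ε : ℝ, 0 < ε → ε < 1 →
    (0 < η ε ∧ η ε < ε) ∧
    ∀ T : X →L[ℝ] Y, ‖T‖ = 1 → ∀ x₀ : X, ‖x₀‖ = 1 → 1 - η ε < ‖T x₀‖ →
      ∃ u₀ : X, ‖u₀‖ = 1 ∧ ∃ S : X →L[ℝ] Y, ‖S‖ = 1 ∧
        ‖S u₀‖ = 1 ∧ ‖u₀ - x₀‖ < ε ∧ ‖S - T‖ < ε

/-- Finitely many rays suffice to decompose every vector without cancellation under finitely
many linear forms, the coefficients being measurable. -/
lemma exists_conic_decomposition {n : ℕ} {κ : Type*} [Fintype κ] [Nonempty κ]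
    (V : κ → Fin n → ℝ) (hV : ∀ y, (∀ k, V k ⬝ᵥ y = 0) → y = 0) :
    ∃ (R : Finset (Fin n → ℝ)) (c : (Fin n → ℝ) → (Fin n → ℝ) → ℝ), 0 ∉ R ∧
      (∀ r, Measurable (c r)) ∧ (∀ r y, 0 ≤ c r y) ∧ (∀ y, y = ∑ r ∈ R, c r y • r) ∧
      ∀ k y, |V k ⬝ᵥ y| = ∑ r ∈ R, c r y * |V k ⬝ᵥ r| := by
  classical
  have hdot : ∀ k, Measurable fun y : Fin n → ℝ => V k ⬝ᵥ y := fun k => by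
    unfold dotProduct; fun_prop
  let σ : (Fin n → ℝ) → κ → Prop × Prop := fun y k => (0 < V k ⬝ᵥ y, V k ⬝ᵥ y < 0)
  have hσ : Measurable σ := by
    refine measurable_pi_lambda _ fun k => Measurable.prodMk ?_ ?_
    · exact measurableSet_setOfPred.1 (measurableSet_lt measurable_const (hdot k))
    · exact measurableSet_setOfPred.1 (measurableSet_lt (hdot k) measurable_const)
  let rep : (Fin n → ℝ) → Fin n → ℝ := fun y => Function.invFun σ (σ y)
  have hrep : ∀ y, σ (rep y) = σ y := fun y => Function.invFun_eq ⟨y, rfl⟩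
  have hrepm : Measurable rep := (Measurable.of_discrete (f := Function.invFun σ)).comp hσ
  have hfin : (Set.range rep).Finite :=
    (Set.finite_range (Function.invFun σ)).subset (by rintro _ ⟨y, rfl⟩; exact ⟨_, rfl⟩)
  let τ : (Fin n → ℝ) → ℝ := fun y =>
    (Finset.univ.sup' Finset.univ_nonempty fun k => (V k ⬝ᵥ rep y) / (V k ⬝ᵥ y))⁻¹
  have hτm : Measurable τ := by
    refine Measurable.inv ?_
    have := Finset.measurable_sup' (s := (Finset.univ : Finset κ)) Finset.univ_nonempty
      (f := fun k (y : Fin n → ℝ) => (V k ⬝ᵥ rep y) / (V k ⬝ᵥ y))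
      (fun k _ => ((hdot k).comp hrepm).div (hdot k))
    convert this using 1
    ext y
    simp [Finset.sup'_apply]
  let R := hfin.toFinset.erase 0
  have hpos : ∀ y k, 0 < V k ⬝ᵥ rep y ↔ 0 < V k ⬝ᵥ y := fun y k => by
    have := congrArg Prod.fst (congrFun (hrep y) k)
    exact iff_of_eq this
  have hneg : ∀ y k, V k ⬝ᵥ rep y < 0 ↔ V k ⬝ᵥ y < 0 := fun y k => by
    have := congrArg Prod.snd (congrFun (hrep y) k)
    exact iff_of_eq this
  have hτ0 : ∀ y, y ≠ 0 → 0 < τ y ∧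
      (∀ k, |V k ⬝ᵥ y| = τ y * |V k ⬝ᵥ rep y| + |V k ⬝ᵥ (y - τ y • rep y)|) ∧
      ∃ k, V k ⬝ᵥ y ≠ 0 ∧ V k ⬝ᵥ (y - τ y • rep y) = 0 := by
    intro y hy
    obtain ⟨k₁, hk₁⟩ : ∃ k, V k ⬝ᵥ y ≠ 0 := by
      by_contra! h; exact hy (hV y h)
    set M := Finset.univ.sup' Finset.univ_nonempty fun k => (V k ⬝ᵥ rep y) / (V k ⬝ᵥ y) with hM
    have hle : ∀ k, (V k ⬝ᵥ rep y) / (V k ⬝ᵥ y) ≤ M := fun k =>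
      Finset.le_sup' (fun k => (V k ⬝ᵥ rep y) / (V k ⬝ᵥ y)) (Finset.mem_univ k)
    have hMpos : 0 < M := by
      refine lt_of_lt_of_le ?_ (hle k₁)
      rcases lt_or_gt_of_ne hk₁ with h | h
      · exact div_pos_of_neg_of_neg ((hneg y k₁).2 h) h
      · exact div_pos ((hpos y k₁).2 h) h
    have hτM : τ y = M⁻¹ := rfl
    obtain ⟨k₀, -, hk₀⟩ := Finset.exists_mem_eq_sup' (Finset.univ_nonempty (α := κ))
      fun k => (V k ⬝ᵥ rep y) / (V k ⬝ᵥ y)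
    rw [← hM] at hk₀
    have hk₀' : V k₀ ⬝ᵥ y ≠ 0 := by
      intro h; rw [h, div_zero] at hk₀; exact hMpos.ne' hk₀
    refine ⟨by rw [hτM]; positivity, fun k => ?_, k₀, hk₀', ?_⟩
    · rw [dotProduct_sub, dotProduct_smul, smul_eq_mul, hτM]
      have hk := hle k
      rcases lt_trichotomy (V k ⬝ᵥ y) 0 with h | h | h
      · have h' := (hneg y k).2 h
        rw [div_le_iff_of_neg h] at hk
        have : V k ⬝ᵥ y ≤ M⁻¹ * V k ⬝ᵥ rep y := by
          rw [← div_eq_inv_mul, le_div_iff₀ hMpos]; linarith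
        rw [abs_of_neg h, abs_of_neg h', abs_of_nonpos (by linarith)]; ring
      · have h' : V k ⬝ᵥ rep y = 0 :=
          le_antisymm (not_lt.1 fun h'' => h.not_gt ((hpos y k).1 h''))
            (not_lt.1 fun h'' => h.not_lt ((hneg y k).1 h''))
        simp [h, h']
      · have h' := (hpos y k).2 h
        rw [div_le_iff₀ h] at hk
        have : M⁻¹ * V k ⬝ᵥ rep y ≤ V k ⬝ᵥ y := by
          rw [← div_eq_inv_mul, div_le_iff₀ hMpos]; linarith
        rw [abs_of_pos h, abs_of_pos h', abs_of_nonneg (by linarith)]; ring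
    · rw [dotProduct_sub, dotProduct_smul, smul_eq_mul, hτM, hk₀, inv_div]
      have : V k₀ ⬝ᵥ rep y ≠ 0 := by
        intro h; rw [h, zero_div] at hk₀; exact hMpos.ne' hk₀
      field_simp
      ring
  let N : (Fin n → ℝ) → ℕ := fun y => (Finset.univ.filter fun k => V k ⬝ᵥ y ≠ 0).card
  have key : ∀ m : ℕ, ∃ c : (Fin n → ℝ) → (Fin n → ℝ) → ℝ,
      (∀ r, Measurable (c r)) ∧ (∀ r y, 0 ≤ c r y) ∧
      ∀ y, N y ≤ m → y = ∑ r ∈ R, c r y • r ∧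
        ∀ k, |V k ⬝ᵥ y| = ∑ r ∈ R, c r y * |V k ⬝ᵥ r| := by
    intro m
    induction m with
    | zero =>
      refine ⟨fun _ _ => 0, fun _ => measurable_const, fun _ _ => le_rfl, fun y hy => ?_⟩
      have h0 : y = 0 := hV y fun k => by
        by_contra h
        have : k ∈ Finset.univ.filter fun k => V k ⬝ᵥ y ≠ 0 := by simpa using h
        rw [Finset.card_eq_zero.1 (Nat.le_zero.1 hy)] at this
        simp at this
      simp [h0]
    | succ m ih =>
      obtain ⟨c, hcm, hc0, hc⟩ := ih
      refine ⟨fun r y => if y = 0 then 0 else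
        (if rep y = r then τ y else 0) + c r (y - τ y • rep y), fun r => ?_, fun r y => ?_,
        fun y hy => ?_⟩
      · refine Measurable.ite (measurableSet_singleton 0) measurable_const (Measurable.add ?_ ?_)
        · exact Measurable.ite (hrepm (measurableSet_singleton r)) hτm measurable_const
        · exact (hcm r).comp (measurable_id.sub (hτm.smul hrepm))
      · by_cases h : y = 0
        · simp [h]
        · simp only [h, if_false]
          have := (hτ0 y h).1.le
          have := hc0 r (y - τ y • rep y)
          split_ifs <;> linarith
      · by_cases h : y = 0
        · simp [h]
        obtain ⟨-, habs, k₀, hk₀, hk₀'⟩ := hτ0 y h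
        have hmem : rep y ∈ R := by
          refine Finset.mem_erase.2 ⟨fun h0 => h (hV y fun k => ?_), by simp⟩
          have h1 := hpos y k
          have h2 := hneg y k
          simp only [h0, dotProduct_zero, lt_self_iff_false, false_iff, not_lt] at h1 h2
          exact le_antisymm h1 h2
        have hlt : N (y - τ y • rep y) < N y := by
          refine Finset.card_lt_card ⟨fun k hk => ?_, fun hsub => ?_⟩
          · simp only [Finset.mem_filter, Finset.mem_univ, true_and] at hk ⊢
            intro hk'
            have := habs k
            rw [hk', abs_zero] at this
            have h1 : 0 ≤ τ y * |V k ⬝ᵥ rep y| := mul_nonneg (hτ0 y h).1.le (abs_nonneg _)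
            exact hk (abs_eq_zero.1 (le_antisymm (by linarith) (abs_nonneg _)))
          · have : k₀ ∈ Finset.univ.filter fun k => V k ⬝ᵥ y ≠ 0 := by simpa using hk₀
            exact (Finset.mem_filter.1 (hsub this)).2 hk₀'
        obtain ⟨e1, e2⟩ := hc (y - τ y • rep y) (by omega)
        simp only [h, if_false, add_smul, add_mul, Finset.sum_add_distrib, ite_smul, zero_smul,
          ite_mul, zero_mul, Finset.sum_ite_eq, hmem, if_true]
        refine ⟨?_, fun k => ?_⟩
        · rw [← e1]; simp
        · rw [← e2, ← habs]
  obtain ⟨c, hcm, hc0, hc⟩ := key (Fintype.card κ)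
  have hN : ∀ y, N y ≤ Fintype.card κ := fun y => Finset.card_le_univ _
  exact ⟨R, c, Finset.notMem_erase _ _, hcm, hc0, fun y => (hc y (hN y)).1,
    fun k y => (hc y (hN y)).2 k⟩

/-- On a compact set, points where a continuous function is close to at least `1` are close to
points where it is at least `1`. -/
lemma exists_near_superlevel {P : Type*} [PseudoMetricSpace P] {Q : Set P} (hQ : IsCompact Q)
    {h : P → ℝ} (hh : Continuous h) {ε : ℝ} (hε : 0 < ε) :
    ∃ η > 0, ∀ p ∈ Q, 1 - η < h p → ∃ p' ∈ Q, 1 ≤ h p' ∧ dist p' p < ε := by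
  set Q' : Set P := Q ∩ ⋂ p' ∈ {p' | p' ∈ Q ∧ 1 ≤ h p'}, {p | ε ≤ dist p' p}
  have hQ' : IsCompact Q' := hQ.inter_right <| isClosed_biInter fun p' _ =>
    isClosed_le continuous_const (continuous_const.dist continuous_id)
  have hlt : ∀ p ∈ Q', h p < 1 := by
    rintro p ⟨hp, hp'⟩
    by_contra! hge
    have := Set.mem_iInter₂.1 hp' p ⟨hp, hge⟩
    simp only [Set.mem_ofPred_eq, dist_self] at this
    linarith
  obtain ⟨η, hη, hη'⟩ : ∃ η > 0, ∀ p ∈ Q', h p ≤ 1 - η := by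
    rcases Q'.eq_empty_or_nonempty with he | hne
    · exact ⟨1, one_pos, by simp [he]⟩
    · obtain ⟨p, hp, hmax⟩ := hQ'.exists_isMaxOn hne hh.continuousOn
      exact ⟨1 - h p, by linarith [hlt p hp], fun q hq => by linarith [isMaxOn_iff.1 hmax q hq]⟩
  refine ⟨η, hη, fun p hp hlt => ?_⟩
  by_contra! hcon
  have : p ∈ Q' := ⟨hp, Set.mem_iInter₂.2 fun p' hp' => hcon p' hp'.1 hp'.2⟩
  linarith [hη' p this]

/-- A finite family in `L₁(μ)` is a combination of finitely many nonnegative functions, with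
coefficient vectors from a prescribed finite set `R`, on which the norm is additive for the given
test combinations `V` and for the additional combination `x`. -/
lemma exists_L1_decomposition {n : ℕ} {κ : Type*} [Fintype κ]
    {V : κ → Fin n → ℝ} (hV : ∀ y, (∀ k, V k ⬝ᵥ y = 0) → y = 0)
    {R : Finset (Fin n → ℝ)} {c : (Fin n → ℝ) → (Fin n → ℝ) → ℝ} (hR : 0 ∉ R)
    (hcm : ∀ r, Measurable (c r)) (hc0 : ∀ r y, 0 ≤ c r y)
    (hc : ∀ y, y = ∑ r ∈ R, c r y • r)
    (hcV : ∀ k y, |V k ⬝ᵥ y| = ∑ r ∈ R, c r y * |V k ⬝ᵥ r|)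
    {α : Type*} {_ : MeasurableSpace α} {μ : Measure α} (y : Fin n → Lp ℝ 1 μ) (x : Fin n → ℝ) :
    ∃ G : R × Bool → Lp ℝ 1 μ,
      (∀ i, y i = ∑ p, (p.1 : Fin n → ℝ) i • G p) ∧
      (∀ k, ∑ p, ‖G p‖ * |V k ⬝ᵥ p.1| ≤ ‖∑ i, V k i • y i‖) ∧
      (‖∑ i, x i • y i‖ ≤ ∑ p, (if p.2 then 1 else -1) * ((x ⬝ᵥ p.1) * ‖G p‖)) ∧
      ∀ b : R × Bool → ℝ, ∑ p, (if p.2 then 1 else -1) * (b p * ‖G p‖) ≤ ‖∑ p, b p • G p‖ := by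
  classical
  let Y : α → Fin n → ℝ := fun ω i => y i ω
  have hYm : Measurable Y := measurable_pi_lambda _ fun i => (Lp.stronglyMeasurable (y i)).measurable
  have hYi : ∀ i, Integrable (fun ω => Y ω i) μ := fun i => L1.integrable_coeFn (y i)
  have hdoti : ∀ v : Fin n → ℝ, Integrable (fun ω => v ⬝ᵥ Y ω) μ := fun v => by
    unfold dotProduct
    exact integrable_finsetSum _ fun i _ => (hYi i).const_mul _
  have hdotm : ∀ v : Fin n → ℝ, Measurable (fun ω => v ⬝ᵥ Y ω) := fun v => by
    unfold dotProduct
    exact Finset.measurable_sum _ fun i _ => ((measurable_pi_apply i).comp hYm).const_mul _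
  have hcomb : ∀ v : Fin n → ℝ, ⇑(∑ i, v i • y i) =ᵐ[μ] fun ω => v ⬝ᵥ Y ω := fun v => by
    have h1 := Lp.coeFn_finsetSum Finset.univ fun i => v i • y i
    have h2 : ∀ᵐ ω ∂μ, ∀ i, (v i • y i : Lp ℝ 1 μ) ω = v i * y i ω :=
      ae_all_iff.2 fun i => by
        filter_upwards [Lp.coeFn_smul (v i) (y i)] with ω h using by simpa using h
    filter_upwards [h1, h2] with ω h1 h2
    rw [h1, Finset.sum_apply]
    exact Finset.sum_congr rfl fun i _ => h2 i
  have hnorm : ∀ v : Fin n → ℝ, ‖∑ i, v i • y i‖ = ∫ ω, |v ⬝ᵥ Y ω| ∂μ := fun v => by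
    rw [L1.norm_eq_integral_norm]
    refine integral_congr_ae ?_
    filter_upwards [hcomb v] with ω h
    rw [h, Real.norm_eq_abs]
  let g : R × Bool → α → ℝ := fun p ω =>
    if decide (0 ≤ x ⬝ᵥ Y ω) = p.2 then c p.1 (Y ω) else 0
  have hg0 : ∀ p ω, 0 ≤ g p ω := fun p ω => by
    simp only [g]; split_ifs
    · exact hc0 _ _
    · exact le_rfl
  have hgm : ∀ p, Measurable (g p) := fun p => by
    have hs : MeasurableSet {ω | 0 ≤ x ⬝ᵥ Y ω} := measurableSet_le measurable_const (hdotm x)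
    refine Measurable.ite ?_ ((hcm p.1).comp hYm) measurable_const
    rcases p with ⟨r, b⟩
    cases b
    · convert hs.compl using 1
      ext ω; simp
    · convert hs using 1
      ext ω; simp
  have hgi : ∀ p, Integrable (g p) μ := fun p => by
    obtain ⟨k, hk⟩ : ∃ k, V k ⬝ᵥ (p.1 : Fin n → ℝ) ≠ 0 := by
      by_contra! h
      exact hR (hV _ h ▸ p.1.2)
    refine ((hdoti (V k)).abs.mul_const |V k ⬝ᵥ (p.1 : Fin n → ℝ)|⁻¹).mono'
      (hgm p).aestronglyMeasurable (.of_forall fun ω => ?_)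
    rw [Real.norm_eq_abs, abs_of_nonneg (hg0 p ω), ← div_eq_mul_inv, le_div_iff₀ (abs_pos.2 hk),
      hcV k (Y ω)]
    refine le_trans ?_ (Finset.single_le_sum (f := fun r => c r (Y ω) * |V k ⬝ᵥ r|)
      (fun r _ => mul_nonneg (hc0 _ _) (abs_nonneg _)) p.1.2)
    refine mul_le_mul_of_nonneg_right ?_ (abs_nonneg _)
    simp only [g]; split_ifs
    · exact le_rfl
    · exact hc0 _ _
  have hsum : ∀ (ω : α) (F : (Fin n → ℝ) → ℝ),
      ∑ p : R × Bool, g p ω * F p.1 = ∑ r ∈ R, c r (Y ω) * F r := fun ω F => by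
    rw [Fintype.sum_prod_type, ← Finset.sum_coe_sort R]
    refine Finset.sum_congr rfl fun r _ => ?_
    simp only [g, Fintype.sum_bool]
    by_cases h : 0 ≤ x ⬝ᵥ Y ω <;> simp [h]
  have hsign : ∀ (ω : α) (p : R × Bool), (if p.2 then 1 else -1) * g p ω =
      (if 0 ≤ x ⬝ᵥ Y ω then 1 else -1) * g p ω := fun ω p => by
    rcases p with ⟨r, b⟩
    by_cases h : 0 ≤ x ⬝ᵥ Y ω <;> cases b <;> simp [g, h]
  have hdot : ∀ (ω : α) (v : Fin n → ℝ), v ⬝ᵥ Y ω = ∑ p : R × Bool, g p ω * (v ⬝ᵥ p.1) :=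
    fun ω v => by
      rw [hsum ω fun r => v ⬝ᵥ r]
      conv_lhs => rw [hc (Y ω)]
      simp [dotProduct_sum, dotProduct_smul]
  let G : R × Bool → Lp ℝ 1 μ := fun p => (hgi p).toL1 (g p)
  have hGn : ∀ p, ‖G p‖ = ∫ ω, g p ω ∂μ := fun p => by
    rw [L1.norm_eq_integral_norm]
    refine integral_congr_ae ?_
    filter_upwards [(hgi p).coeFn_toL1] with ω h
    rw [h, Real.norm_eq_abs, abs_of_nonneg (hg0 p ω)]
  have hGc : ∀ b : R × Bool → ℝ, ⇑(∑ p, b p • G p) =ᵐ[μ] fun ω => ∑ p, b p * g p ω := fun b => by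
    have h1 := Lp.coeFn_finsetSum Finset.univ fun p => b p • G p
    have h2 : ∀ᵐ ω ∂μ, ∀ p, (b p • G p : Lp ℝ 1 μ) ω = b p * g p ω :=
      ae_all_iff.2 fun p => by
        filter_upwards [Lp.coeFn_smul (b p) (G p), (hgi p).coeFn_toL1] with ω h h'
        rw [h, Pi.smul_apply, smul_eq_mul]
        exact congrArg _ h'
    filter_upwards [h1, h2] with ω h1 h2
    rw [h1, Finset.sum_apply]
    exact Finset.sum_congr rfl fun p _ => h2 p
  have hint : ∀ b : R × Bool → ℝ, Integrable (fun ω => ∑ p, b p * g p ω) μ := fun b =>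
    integrable_finsetSum _ fun p _ => (hgi p).const_mul _
  have hGint : ∀ b : R × Bool → ℝ, ∑ p, b p * ‖G p‖ = ∫ ω, ∑ p, b p * g p ω ∂μ := fun b => by
    rw [integral_finsetSum _ fun p _ => (hgi p).const_mul _]
    simp [hGn, integral_const_mul]
  refine ⟨G, fun i => ?_, fun k => ?_, ?_, fun b => ?_⟩
  · refine Lp.ext ?_
    filter_upwards [hGc fun p => (p.1 : Fin n → ℝ) i] with ω h
    rw [h]
    have := hdot ω (Pi.single i 1)
    simp only [single_dotProduct, one_mul] at this
    rw [show (y i : α → ℝ) ω = Y ω i from rfl, this]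
    exact Finset.sum_congr rfl fun p _ => mul_comm _ _
  · rw [hnorm]
    simp only [mul_comm ‖G _‖]
    rw [hGint fun p => |V k ⬝ᵥ (p.1 : Fin n → ℝ)|]
    refine le_of_eq (integral_congr_ae (.of_forall fun ω => ?_))
    simp only [mul_comm |_|]
    rw [hcV, ← hsum ω fun r => |V k ⬝ᵥ r|]
  · rw [hnorm]
    simp only [← mul_assoc]
    rw [hGint fun p => (if p.2 then 1 else -1) * (x ⬝ᵥ (p.1 : Fin n → ℝ))]
    refine le_of_eq (integral_congr_ae (.of_forall fun ω => ?_))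
    simp only [mul_right_comm _ (x ⬝ᵥ _), hsign]
    simp only [mul_assoc, ← Finset.mul_sum]
    rw [← hdot]
    split_ifs with h
    · rw [abs_of_nonneg h, one_mul]
    · rw [abs_of_neg (not_le.1 h)]; ring
  · rw [L1.norm_eq_integral_norm]
    simp only [← mul_assoc]
    rw [hGint fun p => (if p.2 then 1 else -1) * b p]
    refine integral_mono_ae (hint _) (L1.integrable_coeFn _).norm ?_
    filter_upwards [hGc b] with ω h
    rw [h, Real.norm_eq_abs]
    simp only [mul_right_comm _ (b _), hsign]
    simp only [mul_assoc, ← Finset.mul_sum]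
    simp only [mul_comm (g _ ω)]
    split_ifs
    · rw [one_mul]; exact le_abs_self _
    · rw [neg_one_mul]; exact neg_le_abs _

/-- If finitely many combinations `V` of a family in `L₁(μ)` have norm at most `1` and the
combination `x ∈ K` has norm almost `1`, then family and combination can be perturbed, uniformly
in `μ`, so as to keep the former bounds and attain norm at least `1` in the latter. -/
lemma exists_uniform_L1_correction {n : ℕ} {κ : Type*} [Fintype κ] [Nonempty κ]
    {V : κ → Fin n → ℝ} (hV : ∀ y, (∀ k, V k ⬝ᵥ y = 0) → y = 0)
    {K : Set (Fin n → ℝ)} (hK : IsCompact K) {ε : ℝ} (hε : 0 < ε) :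
    ∃ η > 0, ∀ (α : Type) (_ : MeasurableSpace α) (μ : Measure α) (y : Fin n → Lp ℝ 1 μ),
      (∀ k, ‖∑ i, V k i • y i‖ ≤ 1) → ∀ x ∈ K, 1 - η < ‖∑ i, x i • y i‖ →
      ∃ u ∈ K, ‖u - x‖ < ε ∧ ∃ z : Fin n → Lp ℝ 1 μ, (∀ k, ‖∑ i, V k i • z i‖ ≤ 1) ∧
        1 ≤ ‖∑ i, u i • z i‖ ∧ ∀ i, ‖z i - y i‖ < ε := by
  classical
  obtain ⟨R, c, hR, hcm, hc0, hc, hcV⟩ := exists_conic_decomposition V hV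
  let h : (Fin n → ℝ) × (R × Bool → ℝ) → ℝ := fun q =>
    ∑ p : R × Bool, (if p.2 then 1 else -1) * ((q.1 ⬝ᵥ p.1) * q.2 p)
  have hh : Continuous h := by
    simp only [h, dotProduct]
    fun_prop
  let Q : Finset (R × Bool) → Set ((Fin n → ℝ) × (R × Bool → ℝ)) := fun F =>
    {q | q.1 ∈ K ∧ (∀ p, 0 ≤ q.2 p) ∧ (∀ p, p ∉ F → q.2 p = 0) ∧
      ∀ k, ∑ p, q.2 p * |V k ⬝ᵥ p.1| ≤ 1}
  have hQ : ∀ F, IsCompact (Q F) := by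
    intro F
    have hk : ∀ p : R × Bool, ∃ k, V k ⬝ᵥ (p.1 : Fin n → ℝ) ≠ 0 := by
      intro p
      by_contra! h
      exact hR (hV _ h ▸ p.1.2)
    choose k hk using hk
    refine (hK.prod (isCompact_Icc (a := (0 : R × Bool → ℝ))
      (b := fun p => |V (k p) ⬝ᵥ (p.1 : Fin n → ℝ)|⁻¹))).of_isClosed_subset ?_ ?_
    · have hQF : Q F = Prod.fst ⁻¹' K ∩ ((⋂ p, {q : (Fin n → ℝ) × (R × Bool → ℝ) | 0 ≤ q.2 p}) ∩
          ((⋂ p, ⋂ (_ : p ∉ F), {q : (Fin n → ℝ) × (R × Bool → ℝ) | q.2 p = 0}) ∩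
            ⋂ k, {q : (Fin n → ℝ) × (R × Bool → ℝ) | ∑ p, q.2 p * |V k ⬝ᵥ p.1| ≤ 1})) := by
        ext q
        simp [Q]
      rw [hQF]
      refine (hK.isClosed.preimage continuous_fst).inter (.inter ?_ (.inter ?_ ?_))
      · exact isClosed_iInter fun p => isClosed_le continuous_const (by fun_prop)
      · exact isClosed_iInter fun p => isClosed_iInter fun _ =>
          isClosed_eq (by fun_prop) continuous_const
      · exact isClosed_iInter fun k => isClosed_le (by fun_prop) continuous_const
    · rintro q ⟨h1, h2, -, h4⟩
      refine ⟨h1, h2, fun p => ?_⟩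
      change q.2 p ≤ |V (k p) ⬝ᵥ (p.1 : Fin n → ℝ)|⁻¹
      rw [← one_div, le_div_iff₀ (abs_pos.2 (hk p))]
      exact (Finset.single_le_sum (f := fun p' => q.2 p' * |V (k p) ⬝ᵥ (p'.1 : Fin n → ℝ)|)
        (fun p' _ => mul_nonneg (h2 p') (abs_nonneg _)) (Finset.mem_univ p)).trans (h4 _)
  set C : ℝ := ∑ p : R × Bool, ‖(p.1 : Fin n → ℝ)‖ with hC
  have hC0 : 0 ≤ C := Finset.sum_nonneg fun _ _ => norm_nonneg _
  have hδ : 0 < ε / (1 + C) := by positivity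
  choose η hη hηQ using fun F => exists_near_superlevel (hQ F) hh hδ
  refine ⟨Finset.univ.inf' Finset.univ_nonempty η, ?_, fun α _ μ y hy x hx hxy => ?_⟩
  · rw [gt_iff_lt, Finset.lt_inf'_iff]
    exact fun F _ => hη F
  obtain ⟨G, hGy, hGV, hGx, hGb⟩ := exists_L1_decomposition hV hR hcm hc0 hc hcV y x
  let m : R × Bool → ℝ := fun p => ‖G p‖
  let F : Finset (R × Bool) := Finset.univ.filter fun p => m p ≠ 0
  obtain ⟨⟨u, m'⟩, ⟨hu, hm0, hmF, hmV⟩, hh1, hd⟩ := hηQ F (x, m)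
    ⟨hx, fun p => norm_nonneg _, fun p hp => by simpa [F] using hp, fun k => (hGV k).trans (hy k)⟩
    (by
      have := Finset.inf'_le η (Finset.mem_univ F)
      exact lt_of_lt_of_le (by linarith) hGx)
  simp only at hu hm0 hmF hmV
  rw [Prod.dist_eq, max_lt_iff] at hd
  obtain ⟨hd1, hd2⟩ := hd
  simp only at hd1 hd2
  have hδε : ε / (1 + C) ≤ ε := div_le_self hε.le (by linarith)
  have hmul : ∀ p, m' p / m p * m p = m' p := fun p => by
    by_cases hp : m p = 0
    · rw [hp, mul_zero, hmF p (by simpa [F] using hp)]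
    · exact div_mul_cancel₀ _ hp
  have ha0 : ∀ p, 0 ≤ m' p / m p := fun p => div_nonneg (hm0 p) (norm_nonneg _)
  let z : Fin n → Lp ℝ 1 μ := fun i => ∑ p, (m' p / m p * (p.1 : Fin n → ℝ) i) • G p
  have hz : ∀ v : Fin n → ℝ, ∑ i, v i • z i = ∑ p, (m' p / m p * (v ⬝ᵥ p.1)) • G p := fun v => by
    simp only [z, Finset.smul_sum, smul_smul, dotProduct, Finset.mul_sum, Finset.sum_smul]
    rw [Finset.sum_comm]
    refine Finset.sum_congr rfl fun p _ => Finset.sum_congr rfl fun i _ => ?_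
    congr 1
    ring
  refine ⟨u, hu, ?_, z, fun k => ?_, ?_, fun i => ?_⟩
  · rw [← dist_eq_norm]
    exact hd1.trans_le hδε
  · rw [hz]
    refine (norm_sum_le _ _).trans (le_trans (le_of_eq ?_) (hmV k))
    refine Finset.sum_congr rfl fun p _ => ?_
    rw [norm_smul, Real.norm_eq_abs, abs_mul, abs_of_nonneg (ha0 p), mul_right_comm, hmul]
  · rw [hz]
    refine le_trans (hh1.trans (le_of_eq ?_)) (hGb _)
    refine Finset.sum_congr rfl fun p _ => ?_
    congr 1
    rw [mul_right_comm, hmul, mul_comm]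
  · have hsub : z i - y i = ∑ p, ((m' p / m p - 1) * (p.1 : Fin n → ℝ) i) • G p := by
      rw [hGy i, ← Finset.sum_sub_distrib]
      refine Finset.sum_congr rfl fun p _ => ?_
      rw [← sub_smul]
      congr 1
      ring
    have hterm : ∀ p, ‖((m' p / m p - 1) * (p.1 : Fin n → ℝ) i) • G p‖ ≤
        ε / (1 + C) * ‖(p.1 : Fin n → ℝ)‖ := fun p => by
      have e : ‖((m' p / m p - 1) * (p.1 : Fin n → ℝ) i) • G p‖ =
          |m' p - m p| * |(p.1 : Fin n → ℝ) i| := by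
        rw [norm_smul, Real.norm_eq_abs, abs_mul, mul_right_comm]
        congr 1
        rw [← abs_of_nonneg (norm_nonneg (G p)), ← abs_mul, sub_mul, one_mul]
        exact congrArg (fun t => |t - m p|) (hmul p)
      rw [e]
      refine mul_le_mul ?_ (norm_le_pi_norm (p.1 : Fin n → ℝ) i) (abs_nonneg _) hδ.le
      exact ((dist_le_pi_dist m' m p).trans hd2.le)
    rw [hsub]
    refine ((norm_sum_le _ _).trans (Finset.sum_le_sum fun p _ => hterm p)).trans_lt ?_
    rw [← Finset.mul_sum, ← hC, div_mul_eq_mul_div, div_lt_iff₀ (by positivity)]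
    nlinarith

lemma exists_AHSpL4_modulus {ε : ℝ} (hε : 0 < ε) :
    ∃ γ : ℝ, (0 < γ ∧ γ < ε) ∧ ∀ (α : Type) (_ : MeasurableSpace α) (μ : Measure α)
      (y : Fin 4 → Lp ℝ 1 μ), MY4 y → ∀ A : Finset (Fin 4), A.Nonempty →
      ∀ f : Lp ℝ 1 μ →L[ℝ] ℝ, ‖f‖ = 1 → (∀ i ∈ A, 1 - γ < f (y i)) →
      ∃ z : Fin 4 → Lp ℝ 1 μ, MY4 z ∧ (∀ i, ‖z i - y i‖ < ε) ∧
        ‖∑ i ∈ A, z i‖ = (A.card : ℝ) := by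
  let V : Fin 4 ⊕ Fin 4 × Fin 4 × Fin 4 → Fin 4 → ℝ := Sum.elim (fun i => Pi.single i 1)
    fun t => if t.1 < t.2.1 ∧ t.2.1 < t.2.2 then
      Pi.single t.1 1 - Pi.single t.2.1 1 + Pi.single t.2.2 1 else 0
  have hV : ∀ y, (∀ k, V k ⬝ᵥ y = 0) → y = 0 := fun y hy => by
    ext i
    simpa [V] using hy (.inl i)
  have hMY : ∀ {α : Type} {_ : MeasurableSpace α} {μ : Measure α} (y : Fin 4 → Lp ℝ 1 μ),
      MY4 y ↔ ∀ k, ‖∑ i, V k i • y i‖ ≤ 1 := by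
    intro α _ μ y
    have hs : ∀ i, ∑ l, (Pi.single i 1 : Fin 4 → ℝ) l • y l = y i := fun i => by
      simp [Pi.single_apply, ite_smul]
    have ht : ∀ i j k, ∑ l, (Pi.single i 1 - Pi.single j 1 + Pi.single k 1 : Fin 4 → ℝ) l • y l =
        y i - y j + y k := fun i j k => by
      simp only [Pi.add_apply, Pi.sub_apply, add_smul, sub_smul, Finset.sum_add_distrib,
        Finset.sum_sub_distrib, hs]
    constructor
    · rintro ⟨h1, h2⟩ (i | ⟨i, j, k⟩)
      · simpa only [V, Sum.elim_inl, hs] using h1 i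
      · by_cases h : i < j ∧ j < k
        · simpa only [V, Sum.elim_inr, h, and_self, if_true, ht] using h2 i j k h.1 h.2
        · simp [V, h]
    · refine fun h => ⟨fun i => ?_, fun i j k hij hjk => ?_⟩
      · simpa only [V, Sum.elim_inl, hs] using h (.inl i)
      · simpa only [V, Sum.elim_inr, hij, hjk, and_self, if_true, ht] using h (.inr (i, j, k))
  let x : Finset (Fin 4) → Fin 4 → ℝ := fun A i => if i ∈ A then (A.card : ℝ)⁻¹ else 0
  have hx : ∀ {α : Type} {_ : MeasurableSpace α} {μ : Measure α} (y : Fin 4 → Lp ℝ 1 μ) A,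
      ∑ i, x A i • y i = (A.card : ℝ)⁻¹ • ∑ i ∈ A, y i := by
    intro α _ μ y A
    simp [x, ite_smul, Finset.smul_sum]
  choose η hη H using fun A => exists_uniform_L1_correction hV (isCompact_singleton (x := x A)) hε
  refine ⟨min (Finset.univ.inf' Finset.univ_nonempty η) (ε / 2), ⟨lt_min ?_ (by linarith),
    (min_le_right _ _).trans_lt (by linarith)⟩, fun α _ μ y hy A hA f hf hfy => ?_⟩
  · rw [Finset.lt_inf'_iff]
    exact fun A _ => hη A
  have hcard : (0 : ℝ) < A.card := by exact_mod_cast hA.card_pos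
  have hle : min (Finset.univ.inf' Finset.univ_nonempty η) (ε / 2) ≤ η A :=
    (min_le_left _ _).trans (Finset.inf'_le η (Finset.mem_univ A))
  have hbig : 1 - η A < ‖∑ i, x A i • y i‖ := by
    rw [hx, norm_smul, norm_inv, Real.norm_of_nonneg hcard.le, ← div_eq_inv_mul,
      lt_div_iff₀ hcard]
    have h1 : ∑ i ∈ A, (1 - η A) < ∑ i ∈ A, f (y i) :=
      Finset.sum_lt_sum_of_nonempty hA fun i hi => by linarith [hfy i hi]
    rw [Finset.sum_const, nsmul_eq_mul, ← map_sum] at h1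
    have h2 := (le_abs_self _).trans (f.le_opNorm (∑ i ∈ A, y i))
    rw [hf, one_mul] at h2
    linarith
  obtain ⟨u, rfl, -, z, hzV, hz1, hzy⟩ := H A α _ μ y ((hMY y).1 hy) (x A) rfl hbig
  have hz := (hMY z).2 hzV
  refine ⟨z, hz, hzy, le_antisymm ?_ ?_⟩
  · refine (norm_sum_le_of_le A fun i _ => hz.1 i).trans ?_
    simp
  · rwa [hx, norm_smul, norm_inv, Real.norm_of_nonneg hcard.le, ← div_eq_inv_mul,
      le_div_iff₀ hcard, one_mul] at hz1

lemma norm_le_one_of_sign_vectors {n : ℕ} {Y : Type*} [NormedAddCommGroup Y] [NormedSpace ℝ Y]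
    (S : (Fin n → ℝ) →L[ℝ] Y)
    (hS : ∀ s : Fin n → Bool, ‖S fun i => if s i then 1 else -1‖ ≤ 1) : ‖S‖ ≤ 1 := by
  refine S.opNorm_le_of_unit_norm zero_le_one fun x hx => ?_
  have hconv : Convex ℝ (S ⁻¹' Metric.closedBall 0 1) :=
    (convex_closedBall (0 : Y) 1).linear_preimage (S : (Fin n → ℝ) →ₗ[ℝ] Y)
  have hsub : Set.univ.pi (fun _ : Fin n => ({-1, 1} : Set ℝ)) ⊆ S ⁻¹' Metric.closedBall 0 1 := by
    classical
    intro v hv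
    have hv' : v = fun i => if decide (v i = 1) then 1 else -1 := by
      ext i
      rcases hv i trivial with h | h
      · rw [h]; norm_num
      · rw [Set.mem_singleton_iff] at h
        simp [h]
    rw [Set.mem_preimage, mem_closedBall_zero_iff, hv']
    exact hS _
  have hmem : x ∈ convexHull ℝ (Set.univ.pi fun _ : Fin n => ({-1, 1} : Set ℝ)) := by
    rw [convexHull_pi]
    intro i _
    rw [convexHull_pair, segment_eq_Icc (by norm_num), Set.mem_Icc, ← abs_le]
    exact (norm_le_pi_norm x i).trans hx.le
  simpa using convexHull_min hsub hconv hmem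

lemma exists_BPBp_modulus {n : ℕ} {ε : ℝ} (hε : 0 < ε) :
    ∃ η : ℝ, (0 < η ∧ η < ε) ∧ ∀ (α : Type) (_ : MeasurableSpace α) (μ : Measure α)
      (T : (Fin n → ℝ) →L[ℝ] Lp ℝ 1 μ), ‖T‖ = 1 → ∀ x₀ : Fin n → ℝ, ‖x₀‖ = 1 →
      1 - η < ‖T x₀‖ → ∃ u₀ : Fin n → ℝ, ‖u₀‖ = 1 ∧ ∃ S : (Fin n → ℝ) →L[ℝ] Lp ℝ 1 μ, ‖S‖ = 1 ∧
        ‖S u₀‖ = 1 ∧ ‖u₀ - x₀‖ < ε ∧ ‖S - T‖ < ε := by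
  let V : (Fin n → Bool) → Fin n → ℝ := fun s i => if s i then 1 else -1
  have hV : ∀ y, (∀ k, V k ⬝ᵥ y = 0) → y = 0 := fun y hy => by
    have h : ∑ i, |y i| = 0 := by
      rw [← hy fun i => decide (0 ≤ y i)]
      refine Finset.sum_congr rfl fun i _ => ?_
      by_cases h : 0 ≤ y i
      · simp [V, h]
      · simp [V, h, abs_of_neg (not_le.1 h)]
    ext i
    exact abs_eq_zero.1 ((Finset.sum_eq_zero_iff_of_nonneg fun i _ => abs_nonneg (y i)).1 h i
      (Finset.mem_univ i))
  have hδ : 0 < ε / (n + 1) := by positivity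
  obtain ⟨η, hη, H⟩ := exists_uniform_L1_correction hV (isCompact_sphere (0 : Fin n → ℝ) 1) hδ
  refine ⟨min η (ε / 2), ⟨lt_min hη (by linarith), (min_le_right _ _).trans_lt (by linarith)⟩,
    fun α _ μ T hT x₀ hx₀ hTx => ?_⟩
  have hTy : ∀ x, T x = ∑ i, x i • T (Pi.single i 1) := fun x => by
    conv_lhs => rw [pi_eq_sum_univ' x]
    simp [map_sum, map_smul, Pi.single]
  obtain ⟨u, hu, hux, z, hzV, hz1, hzy⟩ := H α _ μ (fun i => T (Pi.single i 1))
    (fun k => by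
      rw [← hTy]
      refine (T.le_of_opNorm_le hT.le _).trans ?_
      rw [one_mul, pi_norm_le_iff_of_nonneg zero_le_one]
      intro i
      simp only [V]
      split_ifs <;> simp)
    x₀ (by simpa using hx₀) (by
      rw [← hTy]
      linarith [min_le_left η (ε / 2)])
  rw [mem_sphere_zero_iff_norm] at hu
  let S : (Fin n → ℝ) →L[ℝ] Lp ℝ 1 μ := ∑ i, (ContinuousLinearMap.proj i).smulRight (z i)
  have hS : ∀ x, S x = ∑ i, x i • z i := fun x => by simp [S]
  have hS1 : ‖S‖ ≤ 1 := norm_le_one_of_sign_vectors S fun s => by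
    rw [hS]
    exact hzV s
  have hSu : 1 ≤ ‖S u‖ := by rwa [hS]
  have hSu' : ‖S u‖ ≤ ‖S‖ := by simpa [hu] using S.le_opNorm u
  have hεn : ε / (n + 1) ≤ ε := div_le_self hε.le (by linarith [n.cast_nonneg (α := ℝ)])
  refine ⟨u, hu, S, le_antisymm hS1 (hSu.trans hSu'), le_antisymm (hSu'.trans hS1) hSu,
    hux.trans_le hεn, ?_⟩
  refine lt_of_le_of_lt (ContinuousLinearMap.opNorm_le_bound _
    (M := n * (ε / (n + 1))) (by positivity) fun x => ?_) ?_
  · rw [sub_apply, hS, hTy, ← Finset.sum_sub_distrib]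
    refine (norm_sum_le_of_le _ (f := fun i => x i • z i - x i • T (Pi.single i 1))
      (n := fun _ => ε / (n + 1) * ‖x‖) fun i _ => ?_).trans (le_of_eq ?_)
    · rw [← smul_sub, norm_smul, mul_comm]
      exact mul_le_mul (hzy i).le (norm_le_pi_norm x i) (norm_nonneg _) hδ.le
    · simp [mul_assoc]
  · rw [mul_div_assoc', div_lt_iff₀ (by positivity)]
    linarith [mul_comm ε (n : ℝ)]

/-- There is a single function `γ` such that `L₁(μ)` has the AHSp-`ℓ∞⁴` with `γ` for every
positive measure `μ`; consequently, there is a single function `η` such that the pair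
`(ℓ∞⁴, L₁(μ))` has the BPBp with `η` for every positive measure `μ`.
(`Fin 4 → ℝ` carries the sup norm, i.e. it is `ℓ∞⁴`.) -/
theorem stmt19 :
    (∃ γ : ℝ → ℝ, ∀ (α : Type) (_ : MeasurableSpace α) (μ : Measure α),
      AHSpL4With (Lp ℝ 1 μ) γ) ∧
    (∃ η : ℝ → ℝ, ∀ (α : Type) (_ : MeasurableSpace α) (μ : Measure α),
      BPBpWith (Fin 4 → ℝ) (Lp ℝ 1 μ) η) := by
  constructor
  · choose! γ hγ H using fun (ε : ℝ) (hε : 0 < ε) => exists_AHSpL4_modulus hε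
    exact ⟨γ, fun α _ μ ε hε _ => ⟨hγ ε hε, H ε hε α _ μ⟩⟩
  · choose! η hη H using fun (ε : ℝ) (hε : 0 < ε) => exists_BPBp_modulus (n := 4) hε
    exact ⟨η, fun α _ μ ε hε _ => ⟨hη ε hε, H ε hε α _ μ⟩⟩
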